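/- For any 1 ≤ i ≤ m, any a, b ∈ A and any s, t ∈ Sᵢ the following hold: (i) dᵢ((s, a), (ts, ta)) = 0; (ii) dᵢ((s, a), (s, b)) = |s|ᵢ⁻¹·|a − b|ᵢ; (iii) dᵢ((s, a), (1, 0)) = |s|ᵢ⁻¹·|a|ᵢ; (iv) dᵢ((s, a), (t, a)) ≤ |s|ᵢ⁻¹·|t|ᵢ⁻¹·|a|ᵢ·|s − t|ᵢ. -/

import Mathlib

/-- A multiplicative nonarchimedean norm on a (possibly noncommutative) unital ring. -/
def IsMultNorm {A : Type*} [Ring A] (f : A → ℝ) : Prop :=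
  (∀ a, 0 ≤ f a) ∧ (∀ a, f a = 0 ↔ a = 0) ∧
  (∀ a b, f (a + b) ≤ max (f a) (f b)) ∧ f 1 = 1 ∧
  (∀ a b, f (a * b) = f a * f b)

/-- A quasi-abelian multiplicative norm: `|ab - ba| ≤ γ·|ab|` for some `0 < γ < 1`. -/
def IsQuasiAbelian {A : Type*} [Ring A] (f : A → ℝ) : Prop :=
  IsMultNorm f ∧ ∃ γ : ℝ, 0 < γ ∧ γ < 1 ∧ ∀ a b, f (a * b - b * a) ≤ γ * f (a * b)

/-- The saturation of `S` with respect to the norm `f`. -/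
def Sat {A : Type*} [Ring A] (f : A → ℝ) (S : Set A) : Set A :=
  {a | ∃ s ∈ S, ∃ t ∈ S, f (a * t - s) < f s}

/-- `Δ(x,y) = |s|⁻¹·|t|⁻¹·|at − sb|` for `x = (s,a)`, `y = (t,b)`. -/
noncomputable def Delta {A : Type*} [Ring A] (f : A → ℝ) (x y : A × A) : ℝ :=
  (f x.1)⁻¹ * (f y.1)⁻¹ * f (x.2 * y.1 - x.1 * y.2)

/-- `dᵢ(x,y)` : the infimum over `ξ ∈ Sᵢ × A` of `max(Δᵢ(x,ξ), Δᵢ(y,ξ))`. -/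
noncomputable def dI {A : Type*} [Ring A] (f : A → ℝ) (S : Set A) (x y : A × A) : ℝ :=
  sInf {r : ℝ | ∃ ξ : A × A, ξ.1 ∈ Sat f S ∧ r = max (Delta f x ξ) (Delta f y ξ)}

namespace IsMultNorm

variable {A : Type*} [Ring A] {f : A → ℝ}

theorem nonneg (h : IsMultNorm f) (a : A) : 0 ≤ f a := h.1 a

theorem eq_zero_iff (h : IsMultNorm f) (a : A) : f a = 0 ↔ a = 0 := h.2.1 a

theorem add_le_max (h : IsMultNorm f) (a b : A) : f (a + b) ≤ max (f a) (f b) := h.2.2.1 a b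

theorem map_one (h : IsMultNorm f) : f 1 = 1 := h.2.2.2.1

theorem map_mul (h : IsMultNorm f) (a b : A) : f (a * b) = f a * f b := h.2.2.2.2 a b

theorem map_zero (h : IsMultNorm f) : f 0 = 0 := (h.eq_zero_iff 0).2 rfl

theorem map_neg (h : IsMultNorm f) (a : A) : f (-a) = f a := by
  have h1 : f (-1) * f (-1) = 1 := by rw [← h.map_mul, neg_mul_neg, one_mul, h.map_one]
  have h2 : f (-1) = 1 := by nlinarith [h.nonneg (-1)]
  rw [← neg_one_mul, h.map_mul, h2, one_mul]

theorem sub_le_max (h : IsMultNorm f) (a b : A) : f (a - b) ≤ max (f a) (f b) := by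
  simpa [sub_eq_add_neg, h.map_neg] using h.add_le_max a (-b)

theorem map_pow (h : IsMultNorm f) (a : A) (n : ℕ) : f (a ^ n) = f a ^ n := by
  induction n with
  | zero => simp [h.map_one]
  | succ n ih => rw [pow_succ, pow_succ, h.map_mul, ih]

theorem pos_of_mem_sat (h : IsMultNorm f) {S : Set A} {s : A} (hs : s ∈ Sat f S) : 0 < f s := by
  obtain ⟨p, -, q, -, hpq⟩ := hs
  refine (h.nonneg s).lt_of_ne fun h0 => ?_
  rw [(h.eq_zero_iff s).1 h0.symm, zero_mul, zero_sub, h.map_neg] at hpq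
  exact lt_irrefl _ hpq

theorem one_mem_sat (h : IsMultNorm f) {S : Set A} (h1 : (1 : A) ∈ S) : (1 : A) ∈ Sat f S :=
  ⟨1, h1, 1, h1, by simp [h.map_zero, h.map_one]⟩

theorem delta_nonneg (h : IsMultNorm f) (x y : A × A) : 0 ≤ Delta f x y :=
  mul_nonneg (mul_nonneg (inv_nonneg.2 (h.nonneg _)) (inv_nonneg.2 (h.nonneg _))) (h.nonneg _)

theorem dI_le (h : IsMultNorm f) {S : Set A} {x y : A × A} {r : ℝ}
    (H : ∀ ε > 0, ∃ u ∈ Sat f S, ∃ c, Delta f x (u, c) ≤ r + ε ∧ Delta f y (u, c) ≤ r + ε) :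
    dI f S x y ≤ r := by
  refine le_of_forall_pos_le_add fun ε hε => ?_
  obtain ⟨u, hu, c, hx, hy⟩ := H ε hε
  refine le_trans (csInf_le ⟨0, ?_⟩ ⟨(u, c), hu, rfl⟩) (max_le hx hy)
  rintro _ ⟨ξ, -, rfl⟩
  exact (h.delta_nonneg _ _).trans (le_max_left _ _)

theorem le_dI (h : IsMultNorm f) {S : Set A} (h1 : (1 : A) ∈ S) {x y : A × A} {r : ℝ}
    (H : ∀ u ∈ Sat f S, ∀ c, r ≤ max (Delta f x (u, c)) (Delta f y (u, c))) :
    r ≤ dI f S x y := by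
  refine le_csInf ⟨_, (1, 0), h.one_mem_sat h1, rfl⟩ ?_
  rintro _ ⟨⟨u, c⟩, hu, rfl⟩
  exact H u hu c

theorem map_le_of_approx_ore (h : IsMultNorm f) {s u a c : A} {ε : ℝ} (hε : 0 ≤ ε) (ps : 0 < f s)
    (hc : f (a * u - s * c) ≤ ε * (f s * f u)) : f c ≤ ((f s)⁻¹ * f a + ε) * f u := by
  have pa := h.nonneg a
  have pu := h.nonneg u
  have hX : f s * (((f s)⁻¹ * f a + ε) * f u) = f a * f u + ε * (f s * f u) := by field_simp
  have hε' : 0 ≤ ε * (f s * f u) := by positivity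
  have hX' : 0 ≤ f a * f u := by positivity
  refine le_of_mul_le_mul_left ?_ ps
  rw [hX, ← h.map_mul s, show s * c = a * u - (a * u - s * c) by abel]
  refine (h.sub_le_max _ _).trans (max_le ?_ ?_)
  · rw [h.map_mul]; linarith
  · linarith

end IsMultNorm

theorem delta_le_iff {A : Type*} [Ring A] {f : A → ℝ} {s a u c : A} {r : ℝ}
    (hs : 0 < f s) (hu : 0 < f u) :
    Delta f (s, a) (u, c) ≤ r ↔ f (a * u - s * c) ≤ r * (f s * f u) := by
  rw [Delta, ← mul_inv, inv_mul_le_iff₀ (mul_pos hs hu), mul_comm r]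

namespace IsQuasiAbelian

variable {A : Type*} [Ring A] {f : A → ℝ} {S : Set A}

theorem mul_mem_sat (hf : IsQuasiAbelian f) (hS : ∀ a ∈ S, ∀ b ∈ S, a * b ∈ S) {s₁ s₂ : A}
    (h₁ : s₁ ∈ Sat f S) (h₂ : s₂ ∈ Sat f S) : s₁ * s₂ ∈ Sat f S := by
  obtain ⟨h, γ, hγ0, hγ1, hγ⟩ := hf
  obtain ⟨u₁, hu₁, t₁, ht₁, h₁⟩ := h₁
  obtain ⟨u₂, hu₂, t₂, ht₂, h₂⟩ := h₂
  refine ⟨u₁ * u₂, hS _ hu₁ _ hu₂, t₂ * t₁, hS _ ht₂ _ ht₁, ?_⟩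
  have p₁ : 0 < f u₁ := (h.nonneg _).trans_lt h₁
  have p₂ : 0 < f u₂ := (h.nonneg _).trans_lt h₂
  have hst : f s₁ * f t₁ ≤ f u₁ := by
    rw [← h.map_mul]
    simpa [h₁.le] using h.add_le_max (s₁ * t₁ - u₁) u₁
  have e : s₁ * s₂ * (t₂ * t₁) - u₁ * u₂ =
      s₁ * (s₂ * t₂ - u₂) * t₁ + s₁ * (u₂ * t₁ - t₁ * u₂) + (s₁ * t₁ - u₁) * u₂ := by
    noncomm_ring
  rw [e, h.map_mul u₁]
  refine (h.add_le_max _ _).trans_lt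
    (max_lt ((h.add_le_max _ _).trans_lt (max_lt ?_ ?_)) ?_)
  · rw [h.map_mul, h.map_mul]
    calc f s₁ * f (s₂ * t₂ - u₂) * f t₁ = f s₁ * f t₁ * f (s₂ * t₂ - u₂) := by ring
      _ ≤ f u₁ * f (s₂ * t₂ - u₂) := mul_le_mul_of_nonneg_right hst (h.nonneg _)
      _ < f u₁ * f u₂ := mul_lt_mul_of_pos_left h₂ p₁
  · rw [h.map_mul]
    calc f s₁ * f (u₂ * t₁ - t₁ * u₂) ≤ f s₁ * (γ * f (u₂ * t₁)) :=
          mul_le_mul_of_nonneg_left (hγ _ _) (h.nonneg _)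
      _ = γ * (f s₁ * f t₁ * f u₂) := by rw [h.map_mul]; ring
      _ ≤ γ * (f u₁ * f u₂) := by gcongr
      _ < f u₁ * f u₂ := mul_lt_of_lt_one_left (mul_pos p₁ p₂) hγ1
  · rw [h.map_mul]
    exact mul_lt_mul_of_pos_right h₁ p₂

theorem pow_mem_sat (hf : IsQuasiAbelian f) (h1 : (1 : A) ∈ S)
    (hS : ∀ a ∈ S, ∀ b ∈ S, a * b ∈ S) {s : A} (hs : s ∈ Sat f S) (n : ℕ) :
    s ^ n ∈ Sat f S := by
  induction n with
  | zero => simpa using hf.1.one_mem_sat h1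
  | succ n ih => rw [pow_succ]; exact hf.mul_mem_sat hS ih hs

/-- An approximate Ore condition: the `n`-fold commutator of `a` with `s` is the error made when
moving one factor `s` of `a * s ^ n` to the left. -/
theorem exists_approx_ore (hf : IsQuasiAbelian f) (h1 : (1 : A) ∈ S)
    (hS : ∀ a ∈ S, ∀ b ∈ S, a * b ∈ S) {s : A} (hs : s ∈ Sat f S) (a : A) {ε : ℝ} (hε : 0 < ε) :
    ∃ u ∈ Sat f S, ∃ c, f (a * u - s * c) ≤ ε * (f s * f u) := by
  have h := hf.1
  obtain ⟨γ, hγ0, hγ1, hγ⟩ := hf.2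
  have key : ∀ n : ℕ, ∃ c, f (a * s ^ n - s * c) ≤ γ ^ n * f a * f s ^ n := by
    intro n
    induction n with
    | zero => exact ⟨0, by simp⟩
    | succ n ih =>
      obtain ⟨c, hc⟩ := ih
      refine ⟨c * s + (a * s ^ n - s * c), ?_⟩
      have e : a * s ^ (n + 1) - s * (c * s + (a * s ^ n - s * c)) =
          (a * s ^ n - s * c) * s - s * (a * s ^ n - s * c) := by
        rw [pow_succ]; noncomm_ring
      rw [e]
      calc _ ≤ γ * f ((a * s ^ n - s * c) * s) := hγ _ _
        _ = γ * (f (a * s ^ n - s * c) * f s) := by rw [h.map_mul]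
        _ ≤ γ * (γ ^ n * f a * f s ^ n * f s) := by
          have := h.nonneg s
          gcongr
        _ = γ ^ (n + 1) * f a * f s ^ (n + 1) := by ring
  have ps := h.pos_of_mem_sat hs
  have pa : 0 < f a + 1 := by linarith [h.nonneg a]
  obtain ⟨n, hn⟩ := exists_pow_lt_of_lt_one (div_pos (mul_pos hε ps) pa) hγ1
  obtain ⟨c, hc⟩ := key n
  refine ⟨s ^ n, hf.pow_mem_sat h1 hS hs n, c, hc.trans ?_⟩
  rw [lt_div_iff₀ pa] at hn
  rw [h.map_pow, ← mul_assoc]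
  refine mul_le_mul_of_nonneg_right ?_ (pow_nonneg ps.le n)
  linarith [pow_pos hγ0 n]

theorem dI_mul_left (hf : IsQuasiAbelian f) (h1 : (1 : A) ∈ S)
    (hS : ∀ a ∈ S, ∀ b ∈ S, a * b ∈ S) {s t : A} (hs : s ∈ Sat f S) (ht : t ∈ Sat f S) (a : A) :
    dI f S (s, a) (t * s, t * a) = 0 := by
  have h := hf.1
  have ps := h.pos_of_mem_sat hs
  have pt := h.pos_of_mem_sat ht
  refine le_antisymm (h.dI_le fun ε hε => ?_)
    (h.le_dI h1 fun u _ c => (h.delta_nonneg _ _).trans (le_max_left _ _))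
  obtain ⟨u, hu, c, hc⟩ := hf.exists_approx_ore h1 hS hs a hε
  have pu := h.pos_of_mem_sat hu
  refine ⟨u, hu, c, ?_, ?_⟩
  · rwa [delta_le_iff ps pu, zero_add]
  · rw [delta_le_iff (by rw [h.map_mul]; positivity) pu, zero_add, mul_assoc, mul_assoc,
      ← mul_sub, h.map_mul, h.map_mul]
    calc f t * f (a * u - s * c) ≤ f t * (ε * (f s * f u)) := by gcongr
      _ = _ := by ring

theorem dI_same_denom (hf : IsQuasiAbelian f) (h1 : (1 : A) ∈ S)
    (hS : ∀ a ∈ S, ∀ b ∈ S, a * b ∈ S) {s : A} (hs : s ∈ Sat f S) (a b : A) :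
    dI f S (s, a) (s, b) = (f s)⁻¹ * f (a - b) := by
  have h := hf.1
  have ps := h.pos_of_mem_sat hs
  have pab := h.nonneg (a - b)
  refine le_antisymm (h.dI_le fun ε hε => ?_) (h.le_dI h1 fun u hu c => ?_)
  · obtain ⟨u, hu, c, hc⟩ := hf.exists_approx_ore h1 hS hs b hε
    have pu := h.pos_of_mem_sat hu
    have hX : ((f s)⁻¹ * f (a - b) + ε) * (f s * f u) =
        f (a - b) * f u + ε * (f s * f u) := by field_simp
    have hε' : 0 ≤ ε * (f s * f u) := by positivity
    have hX' : 0 ≤ f (a - b) * f u := by positivity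
    refine ⟨u, hu, c, ?_, ?_⟩
    · rw [delta_le_iff ps pu, hX,
        show a * u - s * c = (a - b) * u + (b * u - s * c) by noncomm_ring]
      refine (h.add_le_max _ _).trans (max_le ?_ ?_)
      · rw [h.map_mul]; linarith
      · linarith
    · rw [delta_le_iff ps pu, hX]
      linarith
  · have pu := h.pos_of_mem_sat hu
    have hm := h.sub_le_max (a * u - s * c) (b * u - s * c)
    rw [show a * u - s * c - (b * u - s * c) = (a - b) * u by noncomm_ring, h.map_mul] at hm
    simp only [Delta]
    rw [← mul_max_of_nonneg _ _ (by positivity)]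
    calc (f s)⁻¹ * f (a - b) = (f s)⁻¹ * (f u)⁻¹ * (f (a - b) * f u) := by field_simp
      _ ≤ _ := by gcongr

theorem dI_one_zero (hf : IsQuasiAbelian f) (h1 : (1 : A) ∈ S)
    (hS : ∀ a ∈ S, ∀ b ∈ S, a * b ∈ S) {s : A} (hs : s ∈ Sat f S) (a : A) :
    dI f S (s, a) (1, 0) = (f s)⁻¹ * f a := by
  have h := hf.1
  have ps := h.pos_of_mem_sat hs
  have pa := h.nonneg a
  refine le_antisymm (h.dI_le fun ε hε => ?_) (h.le_dI h1 fun u hu c => ?_)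
  · obtain ⟨u, hu, c, hc⟩ := hf.exists_approx_ore h1 hS hs a hε
    have pu := h.pos_of_mem_sat hu
    refine ⟨u, hu, c, ?_, ?_⟩
    · refine ((delta_le_iff ps pu).2 hc).trans (le_add_of_nonneg_left (by positivity))
    · rw [delta_le_iff (by simp [h.map_one]) pu, zero_mul, one_mul, zero_sub, h.map_neg,
        h.map_one, one_mul]
      exact h.map_le_of_approx_ore hε.le ps hc
  · have pu := h.pos_of_mem_sat hu
    have hm := h.add_le_max (a * u - s * c) (s * c)
    rw [sub_add_cancel, h.map_mul, h.map_mul s] at hm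
    have hD : Delta f (1, 0) (u, c) = (f s)⁻¹ * (f u)⁻¹ * (f s * f c) := by
      simp only [Delta, zero_mul, one_mul, zero_sub, h.map_neg, h.map_one, inv_one]
      field_simp
    rw [hD]
    simp only [Delta]
    rw [← mul_max_of_nonneg _ _ (by positivity)]
    calc (f s)⁻¹ * f a = (f s)⁻¹ * (f u)⁻¹ * (f a * f u) := by field_simp
      _ ≤ _ := by gcongr

theorem dI_same_num_le (hf : IsQuasiAbelian f) (h1 : (1 : A) ∈ S)
    (hS : ∀ a ∈ S, ∀ b ∈ S, a * b ∈ S) {s t : A} (hs : s ∈ Sat f S) (ht : t ∈ Sat f S) (a : A) :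
    dI f S (s, a) (t, a) ≤ (f s)⁻¹ * (f t)⁻¹ * f a * f (s - t) := by
  have h := hf.1
  have ps := h.pos_of_mem_sat hs
  have pt := h.pos_of_mem_sat ht
  have pa := h.nonneg a
  have pst := h.nonneg (s - t)
  have hst : f (s - t) ≤ f s + f t :=
    (h.sub_le_max s t).trans (max_le_add_of_nonneg ps.le pt.le)
  refine h.dI_le fun ε hε => ?_
  set δ := ε * f t / (f s + f t) with hδ
  have pδ : 0 < δ := by positivity
  have hδt : δ * (f s + f t) = ε * f t := by rw [hδ]; field_simp
  obtain ⟨u, hu, c, hc⟩ := hf.exists_approx_ore h1 hS hs a pδ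
  have pu := h.pos_of_mem_sat hu
  have hX : 0 ≤ (f s)⁻¹ * (f t)⁻¹ * f a * f (s - t) := by positivity
  refine ⟨u, hu, c, ?_, ?_⟩
  · have hδε : δ ≤ ε := by
      rw [hδ, div_le_iff₀ (by positivity)]
      nlinarith [mul_pos hε ps]
    exact ((delta_le_iff ps pu).2 hc).trans (by linarith)
  · have hY : ((f s)⁻¹ * (f t)⁻¹ * f a * f (s - t) + ε) * (f t * f u) =
        (f s)⁻¹ * f a * f (s - t) * f u + ε * f t * f u := by field_simp
    have hY' : 0 ≤ (f s)⁻¹ * f a * f (s - t) * f u := by positivity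
    rw [delta_le_iff pt pu, hY, ← hδt,
      show a * u - t * c = (a * u - s * c) + (s - t) * c by noncomm_ring]
    refine (h.add_le_max _ _).trans (max_le ?_ ?_)
    · nlinarith [mul_pos (mul_pos pδ pt) pu]
    · rw [h.map_mul]
      calc f (s - t) * f c ≤ f (s - t) * (((f s)⁻¹ * f a + δ) * f u) :=
            mul_le_mul_of_nonneg_left (h.map_le_of_approx_ore pδ.le ps hc) pst
        _ = (f s)⁻¹ * f a * f (s - t) * f u + δ * f (s - t) * f u := by ring
        _ ≤ _ := by gcongr

end IsQuasiAbelian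

theorem statement5 {A : Type*} [Ring A] {m : ℕ} (hm : 0 < m)
    (f : Fin m → A → ℝ) (hf : ∀ i, IsQuasiAbelian (f i))
    (S : Set A) (h1S : (1 : A) ∈ S) (h0S : (0 : A) ∉ S)
    (hS : ∀ a ∈ S, ∀ b ∈ S, a * b ∈ S)
    (i : Fin m) (a b s t : A) (hs : s ∈ Sat (f i) S) (ht : t ∈ Sat (f i) S) :
    dI (f i) S (s, a) (t * s, t * a) = 0 ∧
    dI (f i) S (s, a) (s, b) = (f i s)⁻¹ * f i (a - b) ∧
    dI (f i) S (s, a) (1, 0) = (f i s)⁻¹ * f i a ∧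
    dI (f i) S (s, a) (t, a) ≤ (f i s)⁻¹ * (f i t)⁻¹ * f i a * f i (s - t) := by
  exact ⟨(hf i).dI_mul_left h1S hS hs ht a, (hf i).dI_same_denom h1S hS hs a b,
    (hf i).dI_one_zero h1S hS hs a, (hf i).dI_same_num_le h1S hS hs ht a⟩
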